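/- Let f(ξ) = (1/2)·ln(1 + ξ/N_D) + (1/2)·ln(1 + ε·ξ/N_U) − ln(1 + ξ/(RSI_D + N_D)) − ln(1 + ε·ξ/(RSI_U + N_U)) for ξ ≥ 0. For every ξ ≥ 0 with ξ > max{RSI_D − N_D, (RSI_U − N_U)/ε}, the derivative satisfies f′(ξ) < 0. -/

import Mathlib

open Real Set

theorem hasDerivAt_log_one_add_mul_div {a N x : ℝ} (hN : 0 < N) (hx : 0 ≤ a * x) :
    HasDerivAt (fun ξ => Real.log (1 + a * ξ / N)) (a / (N + a * x)) x := by
  have hpos : 0 < 1 + a * x / N := by positivity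
  have hsum : 0 < N + a * x := by positivity
  have h := (((hasDerivAt_id' x).const_mul a).div_const N).const_add 1
  convert h.log hpos.ne' using 1
  field_simp

theorem half_mul_div_lt_div_add {a R M : ℝ} (ha : 0 < a) (hR : 0 ≤ R) (hM : 0 < M)
    (h : R < M) : (1 / 2) * (a / M) < a / (R + M) := by
  rw [div_mul_div_comm, one_mul]
  exact div_lt_div_of_pos_left ha (by positivity) (by linarith)

/-- With `f` the half-duplex minus full-duplex rate difference, for every
`ξ ≥ 0` with `ξ > max (RSI_D − N_D) ((RSI_U − N_U)/ε)`, the derivative `f′(ξ)` is negative. -/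
theorem hybrid_duplex_deriv_neg_for_large
    (ND NU RD RU ε : ℝ) (hND : 0 < ND) (hNU : 0 < NU) (hRD : 0 ≤ RD) (hRU : 0 ≤ RU)
    (hε : 0 < ε)
    (f : ℝ → ℝ)
    (hf : f = fun ξ => (1/2) * Real.log (1 + ξ / ND) + (1/2) * Real.log (1 + ε * ξ / NU)
      - Real.log (1 + ξ / (RD + ND)) - Real.log (1 + ε * ξ / (RU + NU))) :
    ∀ ξ, 0 ≤ ξ → max (RD - ND) ((RU - NU) / ε) < ξ → deriv f ξ < 0 := by
  intro ξ hξ hmax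
  obtain ⟨hD, hU⟩ := max_lt_iff.1 hmax
  rw [div_lt_iff₀ hε] at hU
  have hεξ : 0 ≤ ε * ξ := by positivity
  have hξ' : 0 ≤ 1 * ξ := by linarith
  have hderiv := ((((hasDerivAt_log_one_add_mul_div hND hξ').const_mul (1 / 2)).add
    ((hasDerivAt_log_one_add_mul_div hNU hεξ).const_mul (1 / 2))).sub
    (hasDerivAt_log_one_add_mul_div (add_pos_of_nonneg_of_pos hRD hND) hξ')).sub
    (hasDerivAt_log_one_add_mul_div (add_pos_of_nonneg_of_pos hRU hNU) hεξ)
  have hfderiv := hderiv.congr_of_eventuallyEq (f₁ := f) (.of_forall fun x => by simp [hf])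
  rw [hfderiv.deriv]
  have hdown := half_mul_div_lt_div_add (M := ND + 1 * ξ) one_pos hRD (by positivity)
    (by linarith)
  have hup := half_mul_div_lt_div_add (M := NU + ε * ξ) hε hRU (by positivity) (by linarith)
  rw [← add_assoc] at hdown hup
  linarith
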